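/- Fix θ ∈ (0,1) and q = Θ(n^{2(θ−1)}), let G ~ ER(n,q) with k̄ = q·C(n,2), and perform t i.i.d. Bernoulli(p) tests with p = √(2/(q n²)). If for some η > 0 one has t ≥ (1+η)·2e·k̄·ln n for all n, then the COMP decoder satisfies P[Ê_COMP ≠ E(G)] → 0 as n → ∞. -/

import Mathlib

open scoped BigOperators Classical
open Finset Filter

noncomputable section

/-- The set of all potential edges: unordered pairs of distinct nodes of `Fin n`. -/
def allPairs (n : ℕ) : Finset (Sym2 (Fin n)) :=
  Finset.univ.filter fun e => ¬ e.IsDiag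

/-- Both endpoints of the pair `e` lie in the test `L`. -/
def pairIn {n : ℕ} (e : Sym2 (Fin n)) (L : Finset (Fin n)) : Prop :=
  ∀ v ∈ e, v ∈ L

/-- The test `L` covers some edge of the edge set `E` (positive outcome `Y = 1`). -/
def covers {n : ℕ} (E : Finset (Sym2 (Fin n))) (L : Finset (Fin n)) : Prop :=
  ∃ e ∈ E, pairIn e L

/-- ER(n,q) probability weight of a given edge set `E`. -/
def erWeight (n : ℕ) (q : ℝ) (E : Finset (Sym2 (Fin n))) : ℝ :=
  q ^ E.card * (1 - q) ^ ((allPairs n).card - E.card)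

/-- Probability of an event under the Erdős–Rényi random graph ER(n,q). -/
def erProb (n : ℕ) (q : ℝ) (A : Finset (Sym2 (Fin n)) → Prop) : ℝ :=
  ∑ E ∈ (allPairs n).powerset, if A E then erWeight n q E else 0

/-- Bernoulli(p) probability weight of a single test `L ⊆ {1,…,n}`. -/
def testWeight (n : ℕ) (p : ℝ) (L : Finset (Fin n)) : ℝ :=
  p ^ L.card * (1 - p) ^ (n - L.card)

/-- Probability of an event for a single Bernoulli(p) test. -/
def bernProb (n : ℕ) (p : ℝ) (A : Finset (Fin n) → Prop) : ℝ :=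
  ∑ L : Finset (Fin n), if A L then testWeight n p L else 0

/-- Probability weight of `t` i.i.d. Bernoulli(p) tests. -/
def testsWeight (n t : ℕ) (p : ℝ) (Ls : Fin t → Finset (Fin n)) : ℝ :=
  ∏ i, testWeight n p (Ls i)

/-- Probability of an event for `t` i.i.d. Bernoulli(p) tests. -/
def bernTestsProb (n t : ℕ) (p : ℝ) (A : (Fin t → Finset (Fin n)) → Prop) : ℝ :=
  ∑ Ls : Fin t → Finset (Fin n), if A Ls then testsWeight n t p Ls else 0

/-- Joint probability over an ER(n,q) graph and `t` i.i.d. Bernoulli(p) tests. -/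
def erTestsProb (n t : ℕ) (q p : ℝ)
    (A : Finset (Sym2 (Fin n)) → (Fin t → Finset (Fin n)) → Prop) : ℝ :=
  ∑ E ∈ (allPairs n).powerset, ∑ Ls : Fin t → Finset (Fin n),
    if A E Ls then erWeight n q E * testsWeight n t p Ls else 0

/-- Degree of node `v` in the edge set `E`. -/
def degOf {n : ℕ} (E : Finset (Sym2 (Fin n))) (v : Fin n) : ℕ :=
  (E.filter fun e => v ∈ e).card

/-- Maximum degree of the edge set `E`. -/
def maxDeg {n : ℕ} (E : Finset (Sym2 (Fin n))) : ℕ :=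
  Finset.univ.sup (degOf E)

/-- Average number of edges of ER(n, q n): `k̄ = q·C(n,2)`. -/
def kbar (q : ℕ → ℝ) (n : ℕ) : ℝ := q n * (n.choose 2 : ℝ)

/-- Two pairs are vertex-disjoint. -/
def sym2Disjoint {n : ℕ} (e e' : Sym2 (Fin n)) : Prop := ∀ v, v ∈ e → v ∉ e'

/-- The COMP decoder: a pair is declared an edge unless both its nodes appear in some
negative test. -/
def compDecoder (n t : ℕ) (Ls : Fin t → Finset (Fin n)) (Y : Fin t → Prop) :
    Finset (Sym2 (Fin n)) :=
  (allPairs n).filter fun e => ¬ ∃ i, ¬ Y i ∧ pairIn e (Ls i)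

/-- The conditional probability that a Bernoulli(`p`) test contains the pair `f`, given that it
contains the pair `e`; set to `0` for `f = e`. -/
def condWeight {n : ℕ} (p : ℝ) (e f : Sym2 (Fin n)) : ℝ :=
  if f = e then 0 else p ^ (f.toFinset \ e.toFinset).card

lemma mem_allPairs {n : ℕ} {e : Sym2 (Fin n)} : e ∈ allPairs n ↔ ¬ e.IsDiag := by
  simp [allPairs]

lemma card_allPairs (n : ℕ) : (allPairs n).card = n.choose 2 := by
  have h := Sym2.card_subtype_not_diag (α := Fin n)
  rw [Fintype.card_subtype, Fintype.card_fin] at h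
  rw [← h, allPairs]

lemma pairIn_iff_toFinset_subset {n : ℕ} {e : Sym2 (Fin n)} {L : Finset (Fin n)} :
    pairIn e L ↔ e.toFinset ⊆ L := by
  simp [pairIn, Finset.subset_iff]

lemma testWeight_nonneg {n : ℕ} {p : ℝ} (hp0 : 0 ≤ p) (hp1 : p ≤ 1) (L : Finset (Fin n)) :
    0 ≤ testWeight n p L :=
  mul_nonneg (pow_nonneg hp0 _) (pow_nonneg (sub_nonneg.2 hp1) _)

lemma erWeight_nonneg {n : ℕ} {q : ℝ} (hq0 : 0 ≤ q) (hq1 : q ≤ 1) (E : Finset (Sym2 (Fin n))) :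
    0 ≤ erWeight n q E :=
  mul_nonneg (pow_nonneg hq0 _) (pow_nonneg (sub_nonneg.2 hq1) _)

lemma sum_testWeight_superset {n : ℕ} (p : ℝ) (S : Finset (Fin n)) :
    ∑ L : Finset (Fin n), (if S ⊆ L then testWeight n p L else 0) = p ^ S.card := by
  have h := Fintype.prod_add (fun _ : Fin n => p) (fun v => if v ∉ S then 1 - p else 0)
  have hl : ∏ v : Fin n, (p + if v ∉ S then 1 - p else 0) = p ^ S.card := by
    rw [← Finset.prod_const, ← Finset.prod_subset (Finset.subset_univ S)]
    · exact Finset.prod_congr rfl fun v hv => by simp [hv]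
    · intro v _ hv
      simp [hv]
  rw [← hl, h]
  refine Finset.sum_congr rfl fun L _ => ?_
  rw [Finset.prod_ite_zero]
  have : (∀ v ∈ Lᶜ, v ∉ S) ↔ S ⊆ L := by
    simp only [Finset.mem_compl, Finset.subset_iff]
    exact forall_congr' fun v => not_imp_not
  by_cases hS : S ⊆ L
  · rw [if_pos hS, if_pos (this.2 hS)]
    simp [testWeight, Finset.card_compl]
  · rw [if_neg hS, if_neg (mt this.1 hS), mul_zero]

lemma sum_testWeight {n : ℕ} (p : ℝ) : ∑ L : Finset (Fin n), testWeight n p L = 1 := by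
  simpa using sum_testWeight_superset (n := n) p ∅

lemma testWeight_mul {n : ℕ} (p : ℝ) (a b : Finset (Fin n)) :
    testWeight n p a * testWeight n p b = testWeight n p (a ∩ b) * testWeight n p (a ∪ b) := by
  have h := Finset.card_inter_add_card_union a b
  have ha := a.card_le_univ
  have hb := b.card_le_univ
  have hi := (a ∩ b).card_le_univ
  have hu := (a ∪ b).card_le_univ
  simp only [Fintype.card_fin] at ha hb hi hu
  have hc : n - a.card + (n - b.card) = n - (a ∩ b).card + (n - (a ∪ b).card) := by omega
  calc testWeight n p a * testWeight n p b
      = p ^ (a.card + b.card) * (1 - p) ^ (n - a.card + (n - b.card)) := by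
        simp only [testWeight, pow_add]; ring
    _ = p ^ ((a ∩ b).card + (a ∪ b).card)
          * (1 - p) ^ (n - (a ∩ b).card + (n - (a ∪ b).card)) := by rw [h, hc]
    _ = _ := by simp only [testWeight, pow_add]; ring

/-- The FKG inequality for two decreasing events under a Bernoulli(`p`) test restricted to
contain `S`. -/
lemma fkg_decreasing_tests {n : ℕ} {p : ℝ} (hp0 : 0 ≤ p) (hp1 : p ≤ 1) (S : Finset (Fin n))
    {A B : Finset (Fin n) → Prop} [DecidablePred A] [DecidablePred B] (hA : ∀ L M, L ⊆ M → A M → A L)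
    (hB : ∀ L M, L ⊆ M → B M → B L) :
    (∑ L : Finset (Fin n), if S ⊆ L ∧ A L then testWeight n p L else 0) *
      (∑ L : Finset (Fin n), if S ⊆ L ∧ B L then testWeight n p L else 0) ≤
    p ^ S.card * ∑ L : Finset (Fin n), if S ⊆ L ∧ (A L ∧ B L) then testWeight n p L else 0 := by
  set μ : Finset (Fin n) → ℝ := fun L => if S ⊆ L then testWeight n p L else 0 with hμ
  have hμ0 : ∀ L, 0 ≤ μ L := fun L => by
    simp only [hμ]
    split_ifs
    exacts [testWeight_nonneg hp0 hp1 _, le_rfl]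
  have hμ_mul : ∀ L M, μ L * μ M ≤ μ (L ∪ M) * μ (L ∩ M) := fun L M => by
    by_cases hLM : S ⊆ L ∧ S ⊆ M
    · simp only [hμ]
      rw [if_pos hLM.1, if_pos hLM.2, if_pos (hLM.1.trans Finset.subset_union_left),
        if_pos (Finset.subset_inter hLM.1 hLM.2), testWeight_mul, mul_comm]
    · have h0 : μ L * μ M = 0 := by
        rw [mul_eq_zero]
        exact (not_and_or.1 hLM).imp (fun h => if_neg h) (fun h => if_neg h)
      rw [h0]
      exact mul_nonneg (hμ0 _) (hμ0 _)
  have key := fkg (α := (Finset (Fin n))ᵒᵈ)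
    (fun L => if A (OrderDual.ofDual L) then (1 : ℝ) else 0)
    (fun L => if B (OrderDual.ofDual L) then (1 : ℝ) else 0)
    (fun L => μ (OrderDual.ofDual L))
    (fun L => hμ0 _)
    (fun L => by dsimp only; split_ifs <;> simp)
    (fun L => by dsimp only; split_ifs <;> simp)
    (fun L M hLM => by
      dsimp only
      have := hA _ _ (OrderDual.ofDual_le_ofDual.2 hLM)
      split_ifs <;> simp_all)
    (fun L M hLM => by
      dsimp only
      have := hB _ _ (OrderDual.ofDual_le_ofDual.2 hLM)
      split_ifs <;> simp_all)
    (fun L M => hμ_mul _ _)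
  have hsum : ∀ f : Finset (Fin n) → ℝ,
      ∑ L : (Finset (Fin n))ᵒᵈ, f (OrderDual.ofDual L) = ∑ L, f L := fun f =>
    Fintype.sum_equiv OrderDual.ofDual _ _ fun _ => rfl
  have hite : ∀ (C : Prop) [Decidable C] (L : Finset (Fin n)),
      (if S ⊆ L ∧ C then testWeight n p L else 0) = μ L * (if C then 1 else 0) := by
    intro C _ L
    by_cases hS : S ⊆ L <;> by_cases hC : C <;> simp [hμ, hS, hC]
  rw [hsum fun L => μ L * (if A L then 1 else 0), hsum fun L => μ L * (if B L then 1 else 0),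
    hsum μ, hsum fun L => μ L * ((if A L then 1 else 0) * (if B L then 1 else 0)),
    sum_testWeight_superset] at key
  have hand : ∀ L, (if A L ∧ B L then (1 : ℝ) else 0) =
      (if A L then 1 else 0) * (if B L then 1 else 0) := fun L => by
    by_cases h1 : A L <;> by_cases h2 : B L <;> simp [h1, h2]
  simp only [hite, hand]
  exact key

lemma condWeight_nonneg {n : ℕ} {p : ℝ} (hp0 : 0 ≤ p) (e f : Sym2 (Fin n)) :
    0 ≤ condWeight p e f := by
  unfold condWeight
  split_ifs
  exacts [le_rfl, pow_nonneg hp0 _]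

lemma toFinset_sdiff_nonempty {n : ℕ} {e f : Sym2 (Fin n)} (he : ¬ e.IsDiag) (hf : ¬ f.IsDiag)
    (hne : f ≠ e) : (f.toFinset \ e.toFinset).Nonempty := by
  rw [Finset.sdiff_nonempty]
  intro hsub
  have heq := Finset.eq_of_subset_of_card_le hsub (by
    rw [Sym2.card_toFinset_of_not_isDiag _ he, Sym2.card_toFinset_of_not_isDiag _ hf])
  refine hne (Sym2.ext fun v => ?_)
  rw [← Sym2.mem_toFinset, heq, Sym2.mem_toFinset]

lemma condWeight_le {n : ℕ} {p : ℝ} (hp0 : 0 ≤ p) (hp1 : p ≤ 1) {e f : Sym2 (Fin n)}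
    (he : ¬ e.IsDiag) (hf : ¬ f.IsDiag) : condWeight p e f ≤ p := by
  unfold condWeight
  split_ifs with h
  · exact hp0
  · exact pow_le_of_le_one hp0 hp1 (toFinset_sdiff_nonempty he hf h).card_pos.ne'

/-- A test contains the non-edge `e` and covers no edge of `E` with probability at least
`p² ∏ (1 - w_f)`, where `w_f` is the conditional probability of covering `f`. -/
lemma prob_negative_test_ge {n : ℕ} {p : ℝ} (hp0 : 0 < p) (hp1 : p ≤ 1) {e : Sym2 (Fin n)}
    (he : ¬ e.IsDiag) (E : Finset (Sym2 (Fin n))) (hE : ∀ f ∈ E, ¬ f.IsDiag) (heE : e ∉ E) :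
    p ^ 2 * ∏ f ∈ E, (1 - condWeight p e f) ≤
      ∑ L : Finset (Fin n),
        if e.toFinset ⊆ L ∧ ¬ covers E L then testWeight n p L else 0 := by
  have hcard := Sym2.card_toFinset_of_not_isDiag _ he
  induction E using Finset.induction_on with
  | empty =>
    have h := sum_testWeight_superset p e.toFinset
    rw [hcard] at h
    simp [covers, h]
  | insert f E hfE ih =>
    have ih := ih (fun g hg => hE g (Finset.mem_insert_of_mem hg))
      (fun h => heE (Finset.mem_insert_of_mem h))
    have hfe : f ≠ e := fun h => heE (h ▸ Finset.mem_insert_self f E)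
    have hf := hE f (Finset.mem_insert_self f E)
    have hfkg := fkg_decreasing_tests hp0.le hp1 e.toFinset
      (A := fun L => ¬ covers E L) (B := fun L => ¬ f.toFinset ⊆ L)
      (fun L M hLM hM hL => hM (by
        obtain ⟨g, hg, hgL⟩ := hL
        exact ⟨g, hg, fun v hv => hLM (hgL v hv)⟩))
      (fun L M hLM hM hL => hM (hL.trans hLM))
    have hunion := sum_testWeight_superset p (e.toFinset ∪ f.toFinset)
    have hsingle : ∑ L : Finset (Fin n),
        (if e.toFinset ⊆ L ∧ ¬ f.toFinset ⊆ L then testWeight n p L else 0)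
          = p ^ 2 * (1 - condWeight p e f) := by
      have hall := sum_testWeight_superset p e.toFinset
      have hun : (e.toFinset ∪ f.toFinset).card = 2 + (f.toFinset \ e.toFinset).card := by
        rw [← Finset.union_sdiff_self_eq_union,
          Finset.card_union_of_disjoint Finset.disjoint_sdiff, hcard]
      rw [hun, pow_add] at hunion
      rw [condWeight, if_neg hfe, mul_sub, mul_one, ← hunion, ← hcard, ← hall,
        ← Finset.sum_sub_distrib]
      refine Finset.sum_congr rfl fun L _ => ?_
      by_cases h1 : e.toFinset ⊆ L <;> by_cases h2 : f.toFinset ⊆ L <;>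
        simp [h1, h2, Finset.union_subset_iff]
    have hw : 0 ≤ 1 - condWeight p e f :=
      sub_nonneg.2 ((condWeight_le hp0.le hp1 he hf).trans hp1)
    have hcov : ∀ L, (¬ covers E L ∧ ¬ f.toFinset ⊆ L) ↔ ¬ covers (insert f E) L := by
      intro L
      simp only [covers, Finset.exists_mem_insert, pairIn_iff_toFinset_subset, not_or]
      exact and_comm
    rw [hsingle, hcard, Finset.sum_congr rfl fun L _ =>
      if_congr (and_congr_right' (hcov L)) rfl rfl] at hfkg
    have hp2 : 0 < p ^ 2 := by positivity
    rw [Finset.prod_insert hfE]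
    refine le_of_mul_le_mul_left (le_trans ?_ hfkg) hp2
    calc p ^ 2 * (p ^ 2 * ((1 - condWeight p e f) * ∏ g ∈ E, (1 - condWeight p e g)))
        = (p ^ 2 * ∏ g ∈ E, (1 - condWeight p e g)) * (p ^ 2 * (1 - condWeight p e f)) := by ring
      _ ≤ _ := mul_le_mul_of_nonneg_right ih (mul_nonneg hp2.le hw)

lemma one_sub_ge_exp {x p : ℝ} (hx0 : 0 ≤ x) (hxp : x ≤ p) (hp1 : p < 1) :
    Real.exp (-(x / (1 - p))) ≤ 1 - x := by
  have hx1 : 0 < 1 - x := by linarith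
  rw [← Real.le_log_iff_exp_le hx1]
  refine le_trans ?_ (Real.one_sub_inv_le_log_of_pos hx1)
  have h : 1 - (1 - x)⁻¹ = -(x / (1 - x)) := by
    field_simp
    ring
  rw [h]
  exact neg_le_neg (div_le_div_of_nonneg_left hx0 (by linarith) (by linarith))

lemma prod_one_sub_condWeight_ge {n : ℕ} {p : ℝ} (hp0 : 0 ≤ p) (hp1 : p < 1) {e : Sym2 (Fin n)}
    (he : ¬ e.IsDiag) (E : Finset (Sym2 (Fin n))) (hE : ∀ f ∈ E, ¬ f.IsDiag) :
    Real.exp (-((∑ f ∈ E, condWeight p e f) / (1 - p))) ≤ ∏ f ∈ E, (1 - condWeight p e f) := by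
  rw [Finset.sum_div, ← Finset.sum_neg_distrib, Real.exp_sum]
  exact Finset.prod_le_prod (fun _ _ => (Real.exp_pos _).le) fun f hf =>
    one_sub_ge_exp (condWeight_nonneg hp0 e f) (condWeight_le hp0 hp1.le he (hE f hf)) hp1

lemma sum_ite_testWeight_nonneg {n : ℕ} {p : ℝ} (hp0 : 0 ≤ p) (hp1 : p ≤ 1)
    (B : Finset (Fin n) → Prop) [DecidablePred B] :
    0 ≤ ∑ L : Finset (Fin n), if B L then testWeight n p L else 0 := by
  refine Finset.sum_nonneg fun L _ => ?_
  split_ifs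
  exacts [testWeight_nonneg hp0 hp1 L, le_rfl]

lemma sum_ite_testWeight_le_one {n : ℕ} {p : ℝ} (hp0 : 0 ≤ p) (hp1 : p ≤ 1)
    (B : Finset (Fin n) → Prop) [DecidablePred B] :
    ∑ L : Finset (Fin n), (if B L then testWeight n p L else 0) ≤ 1 := by
  rw [← sum_testWeight (n := n) p]
  refine Finset.sum_le_sum fun L _ => ?_
  split_ifs
  exacts [le_rfl, testWeight_nonneg hp0 hp1 L]

lemma sum_testsWeight_forall_not {n : ℕ} (t : ℕ) (p : ℝ) (B : Finset (Fin n) → Prop)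
    [DecidablePred B] :
    ∑ Ls : Fin t → Finset (Fin n), (if ∀ i, ¬ B (Ls i) then testsWeight n t p Ls else 0) =
      (1 - ∑ L : Finset (Fin n), if B L then testWeight n p L else 0) ^ t := by
  rw [← sum_testWeight (n := n) p, ← Finset.sum_sub_distrib, Fintype.sum_pow]
  refine Finset.sum_congr rfl fun Ls _ => ?_
  have h : ∀ L : Finset (Fin n), (testWeight n p L - if B L then testWeight n p L else 0) =
      if ¬ B L then testWeight n p L else 0 := fun L => by
    by_cases hB : B L <;> simp [hB]
  simp only [h, testsWeight]
  rw [Finset.prod_ite_zero]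
  by_cases hB : ∀ i, ¬ B (Ls i)
  · rw [if_pos hB, if_pos fun i _ => hB i]
  · rw [if_neg hB, if_neg fun h => hB fun i => h i (Finset.mem_univ i)]

lemma sum_erWeight_mul_prod (n : ℕ) (q : ℝ) (w : Sym2 (Fin n) → ℝ) :
    ∑ E ∈ (allPairs n).powerset, erWeight n q E * ∏ f ∈ E, w f =
      ∏ f ∈ allPairs n, (q * w f + (1 - q)) := by
  rw [Finset.prod_add]
  refine Finset.sum_congr rfl fun E hE => ?_
  rw [Finset.prod_mul_distrib, Finset.prod_const, Finset.prod_const,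
    Finset.card_sdiff_of_subset (Finset.mem_powerset.1 hE), erWeight]
  ring

lemma sum_erWeight (n : ℕ) (q : ℝ) : ∑ E ∈ (allPairs n).powerset, erWeight n q E = 1 := by
  simpa using sum_erWeight_mul_prod n q fun _ => 1

/-- Chernoff bound for a weighted edge count of an Erdős–Rényi graph. -/
lemma erProb_sum_gt_le {n : ℕ} {q : ℝ} (hq0 : 0 ≤ q) (hq1 : q ≤ 1) (w : Sym2 (Fin n) → ℝ)
    {s : ℝ} (hs : 0 ≤ s) (a : ℝ) :
    erProb n q (fun E => a < ∑ f ∈ E, w f) ≤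
      Real.exp (-(s * a) + q * ∑ f ∈ allPairs n, (Real.exp (s * w f) - 1)) := by
  have hmarkov : erProb n q (fun E => a < ∑ f ∈ E, w f) ≤
      Real.exp (-(s * a)) *
        ∑ E ∈ (allPairs n).powerset, erWeight n q E * ∏ f ∈ E, Real.exp (s * w f) := by
    rw [erProb, Finset.mul_sum]
    refine Finset.sum_le_sum fun E _ => ?_
    have hw := erWeight_nonneg hq0 hq1 E
    rw [← Real.exp_sum, ← Finset.mul_sum, mul_left_comm, ← Real.exp_add]
    split_ifs with h
    · refine le_mul_of_one_le_right hw (Real.one_le_exp ?_)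
      have := mul_le_mul_of_nonneg_left h.le hs
      linarith
    · exact mul_nonneg hw (Real.exp_pos _).le
  refine hmarkov.trans ?_
  rw [sum_erWeight_mul_prod, Real.exp_add, Finset.mul_sum, Real.exp_sum]
  refine mul_le_mul_of_nonneg_left (Finset.prod_le_prod (fun f _ => ?_) fun f _ => ?_)
    (Real.exp_pos _).le
  · exact add_nonneg (mul_nonneg hq0 (Real.exp_pos _).le) (sub_nonneg.2 hq1)
  · refine le_trans (le_of_eq ?_) (Real.add_one_le_exp _)
    ring

lemma card_pairs_containing_le {n : ℕ} (v : Fin n) :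
    ((allPairs n).filter fun f => v ∈ f).card ≤ n := by
  have hsub : ((allPairs n).filter fun f => v ∈ f) ⊆ Finset.univ.image fun u => s(v, u) := by
    intro f hf
    obtain ⟨u, rfl⟩ := (Finset.mem_filter.1 hf).2
    exact Finset.mem_image_of_mem _ (Finset.mem_univ u)
  simpa using (Finset.card_le_card hsub).trans Finset.card_image_le

lemma sum_exp_condWeight_sub_one_le {n : ℕ} {p : ℝ} (hp0 : 0 < p) (hp1 : p ≤ 1)
    {e : Sym2 (Fin n)} (he : ¬ e.IsDiag) :
    ∑ f ∈ allPairs n, (Real.exp (1 / p * condWeight p e f) - 1) ≤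
      n.choose 2 * (Real.exp p - 1) + 4 * n := by
  have hexp : 0 ≤ Real.exp p - 1 := sub_nonneg.2 (Real.one_le_exp hp0.le)
  have hterm : ∀ f ∈ allPairs n, Real.exp (1 / p * condWeight p e f) - 1 ≤
      (Real.exp p - 1) + ∑ v ∈ e.toFinset, if v ∈ f then (2 : ℝ) else 0 := by
    intro f hf
    have hf := mem_allPairs.1 hf
    have hnn : ∀ v ∈ e.toFinset, (0 : ℝ) ≤ if v ∈ f then (2 : ℝ) else 0 := fun v _ => by
      split_ifs <;> norm_num
    by_cases hdisj : ∃ v ∈ e.toFinset, v ∈ f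
    · obtain ⟨v, hve, hvf⟩ := hdisj
      have h2 := Finset.single_le_sum hnn hve
      rw [if_pos hvf] at h2
      have hle : 1 / p * condWeight p e f ≤ 1 := by
        rw [one_div_mul_eq_div, div_le_one hp0]
        exact condWeight_le hp0.le hp1 he hf
      have := Real.exp_le_exp.2 hle
      have := Real.exp_one_lt_d9
      linarith
    · push Not at hdisj
      have hw : condWeight p e f ≤ p ^ 2 := by
        unfold condWeight
        split_ifs with h
        · positivity
        · rw [Finset.sdiff_eq_self_of_disjoint, Sym2.card_toFinset_of_not_isDiag _ hf]
          exact Finset.disjoint_right.2 fun v hv hvf => hdisj v hv (Sym2.mem_toFinset.1 hvf)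
      have hle : 1 / p * condWeight p e f ≤ p := by
        rw [one_div_mul_eq_div, div_le_iff₀ hp0, ← sq]
        exact hw
      have := Real.exp_le_exp.2 hle
      have := Finset.sum_nonneg hnn
      linarith
  refine (Finset.sum_le_sum hterm).trans ?_
  rw [Finset.sum_add_distrib, Finset.sum_const, card_allPairs, nsmul_eq_mul, Finset.sum_comm]
  refine add_le_add le_rfl ?_
  have hv : ∀ v ∈ e.toFinset, ∑ f ∈ allPairs n, (if v ∈ f then (2 : ℝ) else 0) ≤ 2 * n := by
    intro v _
    rw [← Finset.sum_filter, Finset.sum_const, nsmul_eq_mul, mul_comm]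
    have : (((allPairs n).filter fun f => v ∈ f).card : ℝ) ≤ n := by
      exact_mod_cast card_pairs_containing_le v
    linarith
  refine (Finset.sum_le_sum hv).trans (le_of_eq ?_)
  rw [Finset.sum_const, Sym2.card_toFinset_of_not_isDiag _ he, nsmul_eq_mul]
  push_cast
  ring

lemma exists_false_positive {n t : ℕ} {E : Finset (Sym2 (Fin n))} (hE : E ⊆ allPairs n)
    {Ls : Fin t → Finset (Fin n)}
    (h : compDecoder n t Ls (fun i => covers E (Ls i)) ≠ E) :
    ∃ e ∈ allPairs n, e ∉ E ∧ ∀ i, ¬ (e.toFinset ⊆ Ls i ∧ ¬ covers E (Ls i)) := by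
  by_contra! hcon
  refine h (Finset.ext fun e => ?_)
  simp only [compDecoder, Finset.mem_filter]
  constructor
  · rintro ⟨he, hno⟩
    by_contra heE
    obtain ⟨i, hi, hc⟩ := hcon e he heE
    exact hno ⟨i, hc, pairIn_iff_toFinset_subset.2 hi⟩
  · rintro heE
    exact ⟨hE heE, fun ⟨i, hc, hi⟩ => hc ⟨e, heE, hi⟩⟩

/-- Given the graph `E`, the pair `e` is a false positive with small probability, provided
the weighted number of edges around `e` is not too large. -/
lemma prob_false_positive_le {n : ℕ} (t : ℕ) {p a : ℝ} (hp0 : 0 < p) (hp1 : p < 1)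
    {e : Sym2 (Fin n)} (he : ¬ e.IsDiag) {E : Finset (Sym2 (Fin n))}
    (hE : E ⊆ allPairs n) (heE : e ∉ E) (ha : ∑ f ∈ E, condWeight p e f ≤ a) :
    ∑ Ls : Fin t → Finset (Fin n), (if ∀ i, ¬ (e.toFinset ⊆ Ls i ∧ ¬ covers E (Ls i))
      then testsWeight n t p Ls else 0) ≤ (1 - p ^ 2 * Real.exp (-(a / (1 - p)))) ^ t := by
  have hE' : ∀ f ∈ E, ¬ f.IsDiag := fun f hf => mem_allPairs.1 (hE hf)
  rw [sum_testsWeight_forall_not t p fun L => e.toFinset ⊆ L ∧ ¬ covers E L]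
  refine pow_le_pow_left₀ (sub_nonneg.2 (sum_ite_testWeight_le_one hp0.le hp1.le _))
    (sub_le_sub_left ?_ 1) t
  refine le_trans ?_ (prob_negative_test_ge hp0 hp1.le he E hE' heE)
  refine mul_le_mul_of_nonneg_left (le_trans ?_ (prod_one_sub_condWeight_ge hp0.le hp1 he E hE'))
    (by positivity)
  rw [Real.exp_le_exp]
  exact neg_le_neg (div_le_div_of_nonneg_right ha (by linarith))

lemma testsWeight_nonneg {n t : ℕ} {p : ℝ} (hp0 : 0 ≤ p) (hp1 : p ≤ 1)
    (Ls : Fin t → Finset (Fin n)) : 0 ≤ testsWeight n t p Ls :=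
  Finset.prod_nonneg fun _ _ => testWeight_nonneg hp0 hp1 _

lemma erTestsProb_nonneg {n t : ℕ} {q p : ℝ} (hq0 : 0 ≤ q) (hq1 : q ≤ 1) (hp0 : 0 ≤ p)
    (hp1 : p ≤ 1) (A : Finset (Sym2 (Fin n)) → (Fin t → Finset (Fin n)) → Prop) :
    0 ≤ erTestsProb n t q p A := by
  refine Finset.sum_nonneg fun E _ => Finset.sum_nonneg fun Ls _ => ?_
  split_ifs
  exacts [mul_nonneg (erWeight_nonneg hq0 hq1 E) (testsWeight_nonneg hp0 hp1 Ls), le_rfl]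

/-- The non-asymptotic error bound for COMP. -/
lemma erTestsProb_comp_error_le {n : ℕ} (t : ℕ) {q p a : ℝ} (hq0 : 0 ≤ q) (hq1 : q ≤ 1)
    (hp0 : 0 < p) (hp1 : p < 1) (ha : 0 ≤ a) :
    erTestsProb n t q p (fun E Ls => compDecoder n t Ls (fun i => covers E (Ls i)) ≠ E) ≤
      n.choose 2 * (Real.exp (-(1 / p * a) + q * (n.choose 2 * (Real.exp p - 1) + 4 * n)) +
        (1 - p ^ 2 * Real.exp (-(a / (1 - p)))) ^ t) := by
  set β : ℝ := (1 - p ^ 2 * Real.exp (-(a / (1 - p)))) ^ t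
  have hβ0 : 0 ≤ β := by
    refine pow_nonneg (sub_nonneg.2 (mul_le_one₀ (pow_le_one₀ hp0.le hp1.le) (Real.exp_pos _).le
      (Real.exp_le_one_iff.2 ?_))) t
    exact neg_nonpos.2 (div_nonneg ha (by linarith))
  have hunion : erTestsProb n t q p
      (fun E Ls => compDecoder n t Ls (fun i => covers E (Ls i)) ≠ E) ≤
      ∑ E ∈ (allPairs n).powerset, ∑ Ls : Fin t → Finset (Fin n), ∑ e ∈ allPairs n,
        if e ∉ E ∧ ∀ i, ¬ (e.toFinset ⊆ Ls i ∧ ¬ covers E (Ls i))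
          then erWeight n q E * testsWeight n t p Ls else 0 := by
    refine Finset.sum_le_sum fun E hE => Finset.sum_le_sum fun Ls _ => ?_
    have hW : 0 ≤ erWeight n q E * testsWeight n t p Ls :=
      mul_nonneg (erWeight_nonneg hq0 hq1 E) (testsWeight_nonneg hp0.le hp1.le Ls)
    have hnn : ∀ e ∈ allPairs n, 0 ≤
        if e ∉ E ∧ ∀ i, ¬ (e.toFinset ⊆ Ls i ∧ ¬ covers E (Ls i))
          then erWeight n q E * testsWeight n t p Ls else 0 := fun e _ => by
      split_ifs
      exacts [hW, le_rfl]
    split_ifs with hbad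
    · obtain ⟨e, he, hfp⟩ := exists_false_positive (Finset.mem_powerset.1 hE) hbad
      have := Finset.single_le_sum hnn he
      rwa [if_pos hfp] at this
    · exact Finset.sum_nonneg hnn
  refine hunion.trans ?_
  simp_rw [Finset.sum_comm (t := allPairs n)]
  have hcard : ∀ F : Sym2 (Fin n) → ℝ, ∀ b : ℝ, (∀ e ∈ allPairs n, F e ≤ b) →
      ∑ e ∈ allPairs n, F e ≤ n.choose 2 * b := fun F b h => by
    rw [← card_allPairs n, ← nsmul_eq_mul]
    exact Finset.sum_le_card_nsmul _ _ _ h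
  refine hcard _ _ fun e he => ?_
  have he := mem_allPairs.1 he
  have hgraph : ∀ E ∈ (allPairs n).powerset, ∑ Ls : Fin t → Finset (Fin n),
      (if e ∉ E ∧ ∀ i, ¬ (e.toFinset ⊆ Ls i ∧ ¬ covers E (Ls i))
        then erWeight n q E * testsWeight n t p Ls else 0) ≤
      (if a < ∑ f ∈ E, condWeight p e f then erWeight n q E else 0) + erWeight n q E * β := by
    intro E hE
    have hw := erWeight_nonneg hq0 hq1 E
    have hrhs : 0 ≤ (if a < ∑ f ∈ E, condWeight p e f then erWeight n q E else 0) := by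
      split_ifs
      exacts [hw, le_rfl]
    by_cases heE : e ∈ E
    · rw [Finset.sum_eq_zero fun Ls _ => if_neg fun h => h.1 heE]
      exact add_nonneg hrhs (mul_nonneg hw hβ0)
    · have hfactor : ∑ Ls : Fin t → Finset (Fin n),
          (if e ∉ E ∧ ∀ i, ¬ (e.toFinset ⊆ Ls i ∧ ¬ covers E (Ls i))
            then erWeight n q E * testsWeight n t p Ls else 0) =
          erWeight n q E * ∑ Ls : Fin t → Finset (Fin n),
            (if ∀ i, ¬ (e.toFinset ⊆ Ls i ∧ ¬ covers E (Ls i))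
              then testsWeight n t p Ls else 0) := by
        rw [Finset.mul_sum]
        refine Finset.sum_congr rfl fun Ls _ => ?_
        rw [mul_ite, mul_zero]
        exact if_congr (and_iff_right heE) rfl rfl
      rw [hfactor]
      by_cases hlarge : a < ∑ f ∈ E, condWeight p e f
      · rw [if_pos hlarge]
        refine le_trans (mul_le_of_le_one_right hw ?_)
          (le_add_of_nonneg_right (mul_nonneg hw hβ0))
        rw [sum_testsWeight_forall_not t p fun L => e.toFinset ⊆ L ∧ ¬ covers E L]
        exact pow_le_one₀ (sub_nonneg.2 (sum_ite_testWeight_le_one hp0.le hp1.le _))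
          (sub_le_self _ (sum_ite_testWeight_nonneg hp0.le hp1.le _))
      · rw [if_neg hlarge, zero_add]
        exact mul_le_mul_of_nonneg_left (prob_false_positive_le t hp0 hp1 he
          (Finset.mem_powerset.1 hE) heE (not_lt.1 hlarge)) hw
  refine (Finset.sum_le_sum hgraph).trans ?_
  rw [Finset.sum_add_distrib, ← Finset.sum_mul, sum_erWeight, one_mul]
  refine add_le_add ((erProb_sum_gt_le hq0 hq1 (condWeight p e) (s := 1 / p)
    (by positivity) a).trans ?_) le_rfl
  rw [Real.exp_le_exp]
  exact add_le_add le_rfl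
    (mul_le_mul_of_nonneg_left (sum_exp_condWeight_sub_one_le hp0 hp1.le he) hq0)

lemma choose_two_le_sq_div_two (n : ℕ) : (n.choose 2 : ℝ) ≤ (n : ℝ) ^ 2 / 2 := by
  rw [Nat.cast_choose_two]
  nlinarith [(Nat.cast_nonneg n : (0 : ℝ) ≤ n)]

/-- The contribution of atypical graphs to the error bound, with `p² = 2 / (q n²)`. -/
lemma atypical_exponent_le {n : ℕ} {q p ε : ℝ} (hq0 : 0 ≤ q) (hp0 : 0 < p) (hp1 : p ≤ 1)
    (hε : 0 < ε) (hpq : p ^ 2 * (q * (n : ℝ) ^ 2) = 2) (hpε : p ≤ ε / 4)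
    (hqε : q ≤ (ε / 16) ^ 2 / 2) :
    -(1 / p * (1 + ε)) + q * (n.choose 2 * (Real.exp p - 1) + 4 * n) ≤ -(ε / 2) * (1 / p) := by
  have hexp : Real.exp p - 1 ≤ p + p ^ 2 := by
    have := (abs_le.1 (Real.abs_exp_sub_one_sub_id_le (abs_le.2 ⟨by linarith, hp1⟩))).2
    linarith
  have hexp0 : 0 ≤ Real.exp p - 1 := sub_nonneg.2 (Real.one_le_exp hp0.le)
  have hnqp : n * q * p ≤ ε / 16 := by
    refine le_of_sq_le_sq ?_ (by positivity)
    nlinarith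
  have hk : q * n.choose 2 * p ^ 2 ≤ 1 := by
    have := mul_le_mul_of_nonneg_left (choose_two_le_sq_div_two n)
      (mul_nonneg hq0 (sq_nonneg p))
    nlinarith
  have hk' : q * n.choose 2 * (Real.exp p - 1) * p ≤ 1 + p := by
    have h0 : 0 ≤ q * n.choose 2 * p := by positivity
    have := mul_le_mul_of_nonneg_left hexp h0
    nlinarith
  refine le_of_mul_le_mul_right ?_ hp0
  have hcancel : 1 / p * p = 1 := by field_simp
  calc (-(1 / p * (1 + ε)) + q * (n.choose 2 * (Real.exp p - 1) + 4 * n)) * p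
      = -(1 / p * p) * (1 + ε) + q * n.choose 2 * (Real.exp p - 1) * p + 4 * (n * q * p) := by
        ring
    _ ≤ -(ε / 2) * (1 / p * p) := by rw [hcancel]; linarith
    _ = _ := by ring

/-- The contribution of typical graphs to the error bound, with `p² = 2 / (q n²)`. -/
lemma typical_bound_le {n t : ℕ} {q p η g κ : ℝ} (hn : 1 ≤ n)
    (hpq : p ^ 2 * (q * (n : ℝ) ^ 2) = 2) (hg0 : 0 ≤ g) (hpg : p ^ 2 * g ≤ 1)
    (ht : (1 + η) * (2 * Real.exp 1 * (q * n.choose 2) * Real.log n) ≤ t)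
    (hκ : κ ≤ (1 + η) * (1 - 1 / n) * (Real.exp 1 * g)) :
    (n.choose 2 : ℝ) * (1 - p ^ 2 * g) ^ t ≤ Real.exp (-(2 * (κ - 1)) * Real.log n) := by
  have hn0 : (0 : ℝ) < n := by exact_mod_cast hn
  have hlog : 0 ≤ Real.log n := Real.log_nonneg (by exact_mod_cast hn)
  have hpow : (1 - p ^ 2 * g) ^ t ≤ Real.exp (-(t * (p ^ 2 * g))) := by
    have h := pow_le_pow_left₀ (sub_nonneg.2 hpg) (Real.one_sub_le_exp_neg (p ^ 2 * g)) t
    rwa [← Real.exp_nat_mul, mul_neg] at h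
  have hk : q * n.choose 2 * p ^ 2 = 1 - 1 / n := by
    rw [Nat.cast_choose_two]
    have : q * (n * (n - 1) / 2) * p ^ 2 = p ^ 2 * (q * (n : ℝ) ^ 2) * ((n - 1) / (2 * n)) := by
      field_simp
    rw [this, hpq]
    field_simp
  have htg : 2 * κ * Real.log n ≤ t * (p ^ 2 * g) := by
    have h1 := mul_le_mul_of_nonneg_right ht (mul_nonneg (sq_nonneg p) hg0)
    have h2 := mul_le_mul_of_nonneg_right hκ hlog
    calc 2 * κ * Real.log n
        ≤ 2 * ((1 + η) * (1 - 1 / n) * (Real.exp 1 * g) * Real.log n) := by linarith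
      _ = (1 + η) * (2 * Real.exp 1 * (q * n.choose 2) * Real.log n) * (p ^ 2 * g) := by
        rw [← hk]; ring
      _ ≤ _ := h1
  have hchoose : (n.choose 2 : ℝ) ≤ Real.exp (2 * Real.log n) := by
    have h : Real.exp (2 * Real.log n) = (n : ℝ) ^ 2 := by
      rw [mul_comm, Real.exp_mul, Real.exp_log hn0, Real.rpow_ofNat]
    rw [h]
    nlinarith [choose_two_le_sq_div_two n, sq_nonneg (n : ℝ)]
  calc (n.choose 2 : ℝ) * (1 - p ^ 2 * g) ^ t
      ≤ Real.exp (2 * Real.log n) * Real.exp (-(2 * κ * Real.log n)) :=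
        mul_le_mul hchoose (hpow.trans (Real.exp_le_exp.2 (neg_le_neg htg)))
          (pow_nonneg (sub_nonneg.2 hpg) t) (Real.exp_pos _).le
    _ = _ := by rw [← Real.exp_add]; ring_nf

/-- COMP upper bound, Theorem 2.
Fix `θ ∈ (0,1)` and `q = Θ(n^{2(θ−1)})`, let `G ~ ER(n,q)` with `k̄ = q·C(n,2)`, and perform
`t` i.i.d. Bernoulli(p) tests with `p = √(2/(q n²))`.  If for some `η > 0` one has
`t ≥ (1+η)·2e·k̄·ln n` for all `n`, then `P[Ê_COMP ≠ E(G)] → 0`. -/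
theorem statement1
    (θ : ℝ) (hθ0 : 0 < θ) (hθ1 : θ < 1)
    (q : ℕ → ℝ) (hq01 : ∀ n, 0 ≤ q n ∧ q n ≤ 1)
    (c₁ c₂ : ℝ) (hc₁ : 0 < c₁)
    (hq : ∀ n : ℕ, c₁ * (n : ℝ) ^ (2 * (θ - 1)) ≤ q n ∧ q n ≤ c₂ * (n : ℝ) ^ (2 * (θ - 1)))
    (t : ℕ → ℕ) (η : ℝ) (hη : 0 < η)
    (ht : ∀ n : ℕ, (1 + η) * (2 * Real.exp 1 * kbar q n * Real.log n) ≤ (t n : ℝ)) :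
    Tendsto (fun n => erTestsProb n (t n) (q n) (Real.sqrt (2 / (q n * (n : ℝ) ^ 2)))
        (fun E Ls => compDecoder n (t n) Ls (fun i => covers E (Ls i)) ≠ E))
      atTop (nhds 0) := by
  set p : ℕ → ℝ := fun n => Real.sqrt (2 / (q n * (n : ℝ) ^ 2)) with hp
  have hnat : Tendsto (fun n : ℕ => (n : ℝ)) atTop atTop := tendsto_natCast_atTop_atTop
  have hlower : ∀ n : ℕ, 1 ≤ n → c₁ * (n : ℝ) ^ (2 * θ) ≤ q n * (n : ℝ) ^ 2 := fun n hn => by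
    have hn0 : (0 : ℝ) < n := by exact_mod_cast hn
    have h : (n : ℝ) ^ (2 * θ) = (n : ℝ) ^ (2 * (θ - 1)) * (n : ℝ) ^ 2 := by
      rw [← Real.rpow_natCast, ← Real.rpow_add hn0]
      congr 1
      push_cast
      ring
    rw [h, ← mul_assoc]
    exact mul_le_mul_of_nonneg_right (hq n).1 (sq_nonneg _)
  have hqn : Tendsto (fun n : ℕ => q n * (n : ℝ) ^ 2) atTop atTop :=
    tendsto_atTop_mono' _ (eventually_atTop.2 ⟨1, hlower⟩)
      (((tendsto_rpow_atTop (by positivity : 0 < 2 * θ)).comp hnat).const_mul_atTop hc₁)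
  have hp_lim : Tendsto p atTop (nhds 0) := by
    have h : Tendsto (fun n : ℕ => 2 / (q n * (n : ℝ) ^ 2)) atTop (nhds 0) :=
      hqn.const_div_atTop 2
    have h0 := (Real.continuous_sqrt.tendsto 0).comp h
    rwa [Real.sqrt_zero] at h0
  have hq_lim : Tendsto q atTop (nhds 0) := by
    have h : Tendsto (fun n : ℕ => c₂ * (n : ℝ) ^ (2 * (θ - 1))) atTop (nhds 0) := by
      have h0 := ((tendsto_rpow_neg_atTop (by linarith : 0 < -(2 * (θ - 1)))).comp hnat).const_mul
        c₂
      simpa using h0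
    exact squeeze_zero (fun n => (hq01 n).1) (fun n => (hq n).2) h
  have hq_pos : ∀ n : ℕ, 1 ≤ n → 0 < q n * (n : ℝ) ^ 2 := fun n hn => by
    have hn0 : (0 : ℝ) < n := by exact_mod_cast hn
    exact lt_of_lt_of_le (by positivity) (hlower n hn)
  have hp_pos : ∀ n : ℕ, 1 ≤ n → 0 < p n := fun n hn =>
    Real.sqrt_pos.2 (div_pos two_pos (hq_pos n hn))
  have hp_sq : ∀ n : ℕ, 1 ≤ n → p n ^ 2 * (q n * (n : ℝ) ^ 2) = 2 := fun n hn => by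
    rw [hp, Real.sq_sqrt (div_pos two_pos (hq_pos n hn)).le, div_mul_cancel₀ _ (hq_pos n hn).ne']
  set ε : ℝ := Real.log (1 + η) / 2 with hε_def
  have hlogη : 0 < Real.log (1 + η) := Real.log_pos (by linarith)
  have hε : 0 < ε := half_pos hlogη
  set g : ℕ → ℝ := fun n => Real.exp (-((1 + ε) / (1 - p n)))
  set κlim : ℝ := (1 + η) * (Real.exp 1 * Real.exp (-(1 + ε))) with hκlim
  have hκlim_gt : 1 < κlim := by
    have h : κlim = Real.exp ε := by
      rw [hκlim, ← Real.exp_log (by linarith : 0 < 1 + η), ← Real.exp_add, ← Real.exp_add]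
      congr 1
      linarith
    rw [h]
    exact Real.one_lt_exp_iff.2 hε
  obtain ⟨κ, hκ1, hκ⟩ := exists_between hκlim_gt
  have hκ_ev : ∀ᶠ n : ℕ in atTop, κ ≤ (1 + η) * (1 - 1 / n) * (Real.exp 1 * g n) := by
    have h1 : Tendsto (fun n : ℕ => 1 - 1 / (n : ℝ)) atTop (nhds (1 - 0)) :=
      tendsto_const_nhds.sub (hnat.const_div_atTop 1)
    have h2 : Tendsto (fun n => (1 + ε) / (1 - p n)) atTop (nhds ((1 + ε) / (1 - 0))) :=
      tendsto_const_nhds.div (tendsto_const_nhds.sub hp_lim) (by norm_num)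
    have h3 : Tendsto g atTop (nhds (Real.exp (-((1 + ε) / (1 - 0))))) :=
      (Real.continuous_exp.tendsto _).comp h2.neg
    have h4 := (h1.const_mul (1 + η)).mul (h3.const_mul (Real.exp 1))
    simp only [sub_zero, div_one, mul_one] at h4
    exact (h4.eventually (lt_mem_nhds hκ)).mono fun n hn => hn.le
  have hinv : Tendsto (fun n => 1 / p n) atTop atTop := by
    have h : Tendsto p atTop (nhdsWithin 0 (Set.Ioi 0)) :=
      tendsto_nhdsWithin_iff.2 ⟨hp_lim, eventually_atTop.2 ⟨1, hp_pos⟩⟩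
    simp only [one_div]
    exact h.inv_tendsto_nhdsGT_zero
  have hatyp : Tendsto (fun n => (2 / c₁) ^ (1 / θ) *
      ((1 / p n) ^ (2 / θ) * Real.exp (-(ε / 2) * (1 / p n)))) atTop (nhds 0) := by
    simpa using ((tendsto_rpow_mul_exp_neg_mul_atTop_nhds_zero (2 / θ) (ε / 2)
      (half_pos hε)).comp hinv).const_mul ((2 / c₁) ^ (1 / θ))
  have htyp : Tendsto (fun n : ℕ => Real.exp (-(2 * (κ - 1)) * Real.log n)) atTop (nhds 0) :=
    Real.tendsto_exp_atBot.comp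
      ((Real.tendsto_log_atTop.comp hnat).const_mul_atTop_of_neg (by linarith))
  have hchoose : ∀ n : ℕ, 1 ≤ n →
      (n.choose 2 : ℝ) ≤ (2 / c₁) ^ (1 / θ) * (1 / p n) ^ (2 / θ) := fun n hn => by
    have hn0 : (0 : ℝ) < n := by exact_mod_cast hn
    have hp0 := hp_pos n hn
    have hsq : (n : ℝ) ^ 2 = ((n : ℝ) ^ (2 * θ)) ^ (1 / θ) := by
      rw [← Real.rpow_mul hn0.le, ← Real.rpow_natCast]
      congr 1
      field_simp
      norm_num
    have hle : (n : ℝ) ^ (2 * θ) ≤ 2 / c₁ * (1 / p n) ^ (2 : ℝ) := by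
      rw [Real.rpow_two, div_mul_eq_mul_div, le_div_iff₀ hc₁, mul_comm]
      refine (hlower n hn).trans (le_of_eq ?_)
      rw [← hp_sq n hn]
      field_simp
    calc (n.choose 2 : ℝ) ≤ (n : ℝ) ^ 2 := by
          nlinarith [choose_two_le_sq_div_two n, sq_nonneg (n : ℝ)]
      _ ≤ (2 / c₁ * (1 / p n) ^ (2 : ℝ)) ^ (1 / θ) := by
          rw [hsq]
          exact Real.rpow_le_rpow (by positivity) hle (by positivity)
      _ = _ := by
          rw [Real.mul_rpow (by positivity) (by positivity), ← Real.rpow_mul (by positivity)]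
          congr 2
          ring
  have hsum := hatyp.add htyp
  rw [add_zero] at hsum
  have hp1 : ∀ᶠ n in atTop, p n < 1 := hp_lim.eventually (gt_mem_nhds one_pos)
  refine squeeze_zero' ?_ ?_ hsum
  · filter_upwards [hp1] with n hn
    exact erTestsProb_nonneg (hq01 n).1 (hq01 n).2 (Real.sqrt_nonneg _) hn.le _
  · filter_upwards [hp1, hκ_ev, eventually_ge_atTop 1,
      hp_lim.eventually (ge_mem_nhds (by positivity : 0 < ε / 4)),
      hq_lim.eventually (ge_mem_nhds (by positivity : 0 < (ε / 16) ^ 2 / 2))]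
      with n hpn hκn hn hpε hqε
    have hp0 := hp_pos n hn
    refine (erTestsProb_comp_error_le (t n) (hq01 n).1 (hq01 n).2 hp0 hpn
      (by linarith : 0 ≤ 1 + ε)).trans ?_
    rw [mul_add]
    refine add_le_add ?_ ?_
    · rw [← mul_assoc]
      exact mul_le_mul (hchoose n hn) (Real.exp_le_exp.2 (atypical_exponent_le (hq01 n).1 hp0
        hpn.le hε (hp_sq n hn) hpε hqε)) (Real.exp_pos _).le (by positivity)
    · refine typical_bound_le hn (hp_sq n hn) (Real.exp_pos _).le ?_ (ht n) hκn
      refine mul_le_one₀ (pow_le_one₀ hp0.le hpn.le) (Real.exp_pos _).le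
        (Real.exp_le_one_iff.2 (neg_nonpos.2 (div_nonneg (by linarith) (by linarith))))

end
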